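/- arXiv:2304.00094 — 2 statements merged into one kernel-verified Lean document; each statement's English description precedes it below -/
import Mathlib

section
/- Let d, N ∈ ℕ with d ≥ 1, let M be a positive even integer, points x_1, …, x_N ∈ [0,1)^d, and weights w_1, …, w_N ∈ ℂ satisfying ∑_{j=1}^N w_j e^{2πi k·x_j} = δ_{0,k} for all k ∈ I_{2M}. Let f : ℝ^d → ℂ be continuous and integrable with |f(x)| ≤ C(1+‖x‖)^{−d−1} for some C > 0, and bandlimited with bandwidth M (i.e., its Fourier transform f̂ vanishes outside [−M/2, M/2)^d). Then the samples of the periodization f̃(x) := ∑_{r∈ℤ^d} f(x+r) yield an exact reconstruction of the Fourier transform at integer frequencies: f̂(k) = ∑_{j=1}^N w_j f̃(x_j) e^{−2πi k·x_j} for all k ∈ I_M. -/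
noncomputable section
open scoped Real BigOperators
open Complex MeasureTheory

/-- The multi-index set `I_M := {k ∈ ℤ^d : -M/2 ≤ k_t < M/2 for all t}`. -/
def indexSet (d M : ℕ) : Finset (Fin d → ℤ) :=
  Finset.Icc (fun _ => -(M : ℤ) / 2) (fun _ => (M : ℤ) / 2 - 1)

/-- The half-open unit cube `(0, 1]^ι`, a fundamental domain for the translations by `ℤ^ι`. -/
def unitCube (ι : Type*) : Set (ι → ℝ) := {x | ∀ i, x i ∈ Set.Ioc (0 : ℝ) (0 + 1)}

variable {ι : Type*} [Fintype ι]

lemma summable_one_add_norm_intCast_rpow {s : ℝ} (hs : (Fintype.card ι : ℝ) < s) :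
    Summable fun r : ι → ℤ => (1 + ‖fun t => (r t : ℝ)‖) ^ (-s) := by
  classical
  let b := Pi.basisFun ℝ ι
  let L := Submodule.span ℤ (Set.range b)
  let e : L ≃ₗ[ℤ] (ι → ℤ) := (b.restrictScalars ℤ).equivFun
  have hrank : Module.finrank ℤ L = Fintype.card ι := by
    rw [e.finrank_eq, Module.finrank_fintype_fun_eq_card]
  have he : ∀ z : L, (fun t => (e z t : ℝ)) = (z : ι → ℝ) := by
    intro z
    ext t
    have := b.restrictScalars_repr_apply ℤ z t
    simpa [e, b] using this
  have hL : Summable fun z : L => ‖z‖ ^ (-s) := by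
    apply ZLattice.summable_norm_rpow
    rw [hrank]
    linarith
  rw [← e.toEquiv.summable_iff]
  refine Summable.of_norm_bounded_eventually hL ?_
  refine (Set.finite_singleton (0 : L)).subset fun z hz => ?_
  by_contra hz0
  apply hz
  have hpos : 0 < ‖z‖ := norm_pos_iff.mpr hz0
  have hcard : (0 : ℝ) ≤ Fintype.card ι := Nat.cast_nonneg _
  have hnorm : ‖fun t => (e z t : ℝ)‖ = ‖z‖ := by rw [he]; rfl
  change ‖(1 + ‖fun t => (e z t : ℝ)‖) ^ (-s)‖ ≤ ‖z‖ ^ (-s)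
  rw [hnorm, Real.norm_of_nonneg (by positivity)]
  exact Real.rpow_le_rpow_of_nonpos hpos (by linarith) (by linarith)

lemma continuous_tsum_comp_add_intCast {f : (ι → ℝ) → ℂ} (hf : Continuous f) {C s : ℝ}
    (hC : 0 ≤ C) (hs : (Fintype.card ι : ℝ) < s)
    (hdecay : ∀ y, ‖f y‖ ≤ C * (1 + ‖y‖) ^ (-s)) :
    Continuous fun y => ∑' r : ι → ℤ, f (y + fun t => (r t : ℝ)) := by
  have hcard : (0 : ℝ) ≤ Fintype.card ι := Nat.cast_nonneg _
  rw [continuous_iff_continuousAt]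
  intro x
  set R := ‖x‖ + 1
  have hR : 0 < 1 + R := by positivity
  have hball : Metric.ball (0 : ι → ℝ) R ∈ nhds x :=
    Metric.isOpen_ball.mem_nhds (by simp [R])
  refine ContinuousOn.continuousAt (continuousOn_tsum (fun r => ?_)
    ((summable_one_add_norm_intCast_rpow hs).mul_left (C * (1 + R) ^ s)) ?_) hball
  · exact (hf.comp (continuous_id.add continuous_const)).continuousOn
  · intro r y hy
    set v : ι → ℝ := fun t => (r t : ℝ)
    have hy' : ‖y‖ < R := by simpa using hy
    have h1 : ‖v‖ ≤ ‖y + v‖ + ‖y‖ := by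
      simpa using norm_sub_le (y + v) y
    have h2 : (1 + ‖v‖) / (1 + R) ≤ 1 + ‖y + v‖ := by
      rw [div_le_iff₀ hR]
      nlinarith [norm_nonneg (y + v), norm_nonneg x]
    calc ‖f (y + v)‖ ≤ C * (1 + ‖y + v‖) ^ (-s) := hdecay _
      _ ≤ C * ((1 + ‖v‖) / (1 + R)) ^ (-s) := by
        gcongr C * ?_
        exact Real.rpow_le_rpow_of_nonpos (by positivity) h2 (by linarith)
      _ = C * (1 + R) ^ s * (1 + ‖v‖) ^ (-s) := by
        rw [Real.div_rpow (by positivity) hR.le, Real.rpow_neg hR.le s, div_inv_eq_mul]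
        ring

lemma hasSum_integral_unitCube {E : Type*} [NormedAddCommGroup E] [NormedSpace ℝ E]
    {g : (ι → ℝ) → E} (hg : Integrable g) :
    HasSum (fun r : ι → ℤ => ∫ x in unitCube ι, g (x + fun t => (r t : ℝ))) (∫ x, g x) := by
  let c : (ι → ℤ) → Set (ι → ℝ) := fun r => {x | ∀ i, x i ∈ Set.Ioc (r i : ℝ) (r i + 1)}
  have hceil : ∀ r x, x ∈ c r → r = fun i => ⌈x i⌉ - 1 := by
    intro r x hx
    ext i
    have := hx i
    rw [eq_sub_iff_add_eq, eq_comm, Int.ceil_eq_iff]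
    push_cast
    exact ⟨by linarith [this.1], this.2⟩
  have hcm : ∀ r, MeasurableSet (c r) := fun r =>
    MeasurableSet.univ_pi' fun i => measurableSet_Ioc
  have hcd : Pairwise (Function.onFun Disjoint c) := by
    intro r r' hne
    refine Set.disjoint_left.mpr fun x hx hx' => hne ?_
    rw [hceil r x hx, hceil r' x hx']
  have hcu : ⋃ r, c r = Set.univ := by
    refine Set.eq_univ_of_forall fun x => Set.mem_iUnion.mpr ⟨fun i => ⌈x i⌉ - 1, fun i => ?_⟩
    push_cast
    exact ⟨by linarith [Int.ceil_lt_add_one (x i)], by linarith [Int.le_ceil (x i)]⟩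
  have h := hasSum_integral_iUnion hcm hcd (hg.integrableOn (s := ⋃ r, c r))
  rw [hcu, setIntegral_univ] at h
  convert h using 2 with r
  have hpre : unitCube ι = (fun x => x + fun t => (r t : ℝ)) ⁻¹' c r := by
    ext x
    simp only [unitCube, c, Set.mem_ofPred_eq, Set.mem_preimage, Pi.add_apply, Set.mem_Ioc]
    exact forall_congr' fun i =>
      ⟨fun h => ⟨by linarith, by linarith⟩, fun h => ⟨by linarith, by linarith⟩⟩
  rw [hpre]
  exact (measurePreserving_add_right volume _).setIntegral_preimage_emb
    (measurableEmbedding_addRight _) g (c r)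

lemma integral_unitCube_tsum {g : (ι → ℝ) → ℂ} (hg : Integrable g) :
    ∫ x in unitCube ι, ∑' r : ι → ℤ, g (x + fun t => (r t : ℝ)) = ∫ x, g x := by
  have hint : ∀ r : ι → ℤ, Integrable (fun x => g (x + fun t => (r t : ℝ)))
      (volume.restrict (unitCube ι)) := fun r => (hg.comp_add_right _).restrict
  exact (hasSum_integral_of_summable_integral_norm hint
    (hasSum_integral_unitCube hg.norm).summable).unique (hasSum_integral_unitCube hg)

lemma mFourier_coe_apply (n : ι → ℤ) (y : ι → ℝ) :
    UnitAddTorus.mFourier n (fun i => (y i : UnitAddCircle)) =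
      Complex.exp (2 * π * I * ∑ t, (n t : ℂ) * (y t : ℂ)) := by
  simp only [UnitAddTorus.mFourier, ContinuousMap.coe_mk, fourier_coe_apply, ← Complex.exp_sum,
    Finset.mul_sum]
  congr 1
  refine Finset.sum_congr rfl fun t _ => ?_
  push_cast
  ring

/-- **Poisson summation** on `ℝ^ι` for functions whose Fourier transform vanishes at all but
finitely many integer points. -/
lemma tsum_comp_add_intCast_eq_sum {f : (ι → ℝ) → ℂ} (hf : Continuous f) (hfi : Integrable f)
    {C s : ℝ} (hC : 0 ≤ C) (hs : (Fintype.card ι : ℝ) < s)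
    (hdecay : ∀ y, ‖f y‖ ≤ C * (1 + ‖y‖) ^ (-s)) {a : (ι → ℤ) → ℂ}
    (ha : ∀ n, a n = ∫ y, f y * Complex.exp (-(2 * π * I) * ∑ t, (n t : ℂ) * (y t : ℂ)))
    {S : Finset (ι → ℤ)} (hS : ∀ n ∉ S, a n = 0) (y : ι → ℝ) :
    ∑' r : ι → ℤ, f (y + fun t => (r t : ℝ)) =
      ∑ n ∈ S, a n * Complex.exp (2 * π * I * ∑ t, (n t : ℂ) * (y t : ℂ)) := by
  let q : C(ι → ℝ, UnitAddTorus ι) :=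
    ⟨Pi.map fun _ => ((↑) : ℝ → UnitAddCircle),
      continuous_pi fun i => (AddCircle.continuous_mk' 1).comp (continuous_apply i)⟩
  have hq : Topology.IsQuotientMap q :=
    (IsOpenQuotientMap.piMap fun _ => QuotientAddGroup.isOpenQuotientMap_mk).isQuotientMap
  let P : C(ι → ℝ, ℂ) :=
    ⟨fun y => ∑' r : ι → ℤ, f (y + fun t => (r t : ℝ)),
      continuous_tsum_comp_add_intCast hf hC hs hdecay⟩
  have hP : Function.FactorsThrough P q := by
    intro u v huv
    have hm : ∀ i, ∃ m : ℤ, u i = v i + m := by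
      intro i
      have hi : (u i : UnitAddCircle) = (v i : UnitAddCircle) := congrFun huv i
      obtain ⟨m, hm⟩ := AddSubgroup.mem_zmultiples_iff.mp (QuotientAddGroup.eq.mp hi.symm)
      refine ⟨m, ?_⟩
      rw [zsmul_one] at hm
      linarith
    choose m hm using hm
    change ∑' r : ι → ℤ, f (u + fun t => (r t : ℝ)) = ∑' r : ι → ℤ, f (v + fun t => (r t : ℝ))
    rw [← (Equiv.addLeft m).tsum_eq fun r : ι → ℤ => f (v + fun t => (r t : ℝ))]
    refine tsum_congr fun r => congrArg f ?_
    ext t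
    simp [hm t, add_assoc]
  let F : C(UnitAddTorus ι, ℂ) := hq.lift P hP
  have hF : ∀ y : ι → ℝ, F (fun i => (y i : UnitAddCircle)) =
      ∑' r : ι → ℤ, f (y + fun t => (r t : ℝ)) := fun y =>
    congrArg (fun g : C(ι → ℝ, ℂ) => g y) (hq.lift_comp P hP)
  have hcoeff : UnitAddTorus.mFourierCoeff F = a := by
    ext n
    rw [UnitAddTorus.mFourierCoeff_eq_integral F n 0, ha n]
    let g : (ι → ℝ) → ℂ := fun y => f y * UnitAddTorus.mFourier (-n) (q y)
    have hg : Integrable g := by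
      refine hfi.mul_bdd (c := 1) ?_ (Filter.Eventually.of_forall fun y => ?_)
      · exact ((map_continuous (UnitAddTorus.mFourier (-n))).comp
          (map_continuous q)).aestronglyMeasurable
      · exact (ContinuousMap.norm_coe_le_norm _ _).trans UnitAddTorus.mFourier_norm.le
    have hgq : ∀ y, g y = f y * Complex.exp (-(2 * π * I) * ∑ t, (n t : ℂ) * (y t : ℂ)) := by
      intro y
      change f y * UnitAddTorus.mFourier (-n) (fun i => (y i : UnitAddCircle)) = _
      rw [mFourier_coe_apply]
      simp [Finset.sum_neg_distrib]
    simp_rw [← hgq]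
    rw [← integral_unitCube_tsum hg]
    refine integral_congr_ae (Filter.Eventually.of_forall fun y => ?_)
    have hqr : ∀ r : ι → ℤ, q (y + fun t => (r t : ℝ)) = q y := by
      intro r
      ext i
      change ((y i + (r i : ℝ) : ℝ) : UnitAddCircle) = (y i : UnitAddCircle)
      rw [AddCircle.coe_add, (AddCircle.coe_eq_zero_iff 1 (x := (r i : ℝ))).mpr ⟨r i, zsmul_one _⟩,
        add_zero]
    simp only [g, hF, hqr, tsum_mul_right, smul_eq_mul]
    exact mul_comm _ _
  have hsum : Summable (UnitAddTorus.mFourierCoeff F) := by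
    rw [hcoeff]
    exact summable_of_ne_finset_zero hS
  have key := UnitAddTorus.hasSum_mFourier_series_apply_of_summable hsum
    (fun i => (y i : UnitAddCircle))
  rw [hF, hcoeff] at key
  rw [← key.tsum_eq, tsum_eq_sum (s := S) fun n hn => by simp [hS n hn]]
  simp only [mFourier_coe_apply, smul_eq_mul]

/-- for density compensation factors satisfying the quadrature
condition on `I_{2M}` and a continuous, integrable, decaying, bandlimited
function `f`, sampling the periodization `f̃` yields an exact reconstruction of
the Fourier transform `f̂(k)` for all `k ∈ I_M`. -/
theorem exact_reconstruction_bandlimited_from_periodization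
    (d N M : ℕ) (hd : 1 ≤ d) (hM : 0 < M) (hMeven : Even M)
    (x : Fin N → Fin d → ℝ) (hx : ∀ j t, x j t ∈ Set.Ico (0 : ℝ) 1)
    (w : Fin N → ℂ)
    (hw : ∀ k ∈ indexSet d (2 * M),
      ∑ j, w j * Complex.exp (2 * π * I * ∑ t, (k t : ℂ) * (x j t : ℂ)) =
        if k = 0 then 1 else 0)
    (f : (Fin d → ℝ) → ℂ) (hfc : Continuous f) (hfi : Integrable f)
    (C : ℝ) (hC : 0 < C)
    (hdecay : ∀ y : Fin d → ℝ, ‖f y‖ ≤ C * (1 + ‖y‖) ^ (-(d : ℝ) - 1))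
    (fhat : (Fin d → ℝ) → ℂ)
    (hfhat : ∀ v : Fin d → ℝ, fhat v =
      ∫ y : Fin d → ℝ, f y * Complex.exp (-(2 * π * I) * ∑ t, (v t : ℂ) * (y t : ℂ)))
    (hband : ∀ v : Fin d → ℝ,
      v ∉ Set.pi Set.univ (fun _ => Set.Ico (-(M : ℝ) / 2) ((M : ℝ) / 2)) → fhat v = 0)
    (ftilde : (Fin d → ℝ) → ℂ)
    (hftilde : ∀ y, ftilde y = ∑' r : Fin d → ℤ, f (y + fun t => (r t : ℝ))) :
    ∀ k ∈ indexSet d M,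
      fhat (fun t => (k t : ℝ)) =
        ∑ j, w j * ftilde (x j) *
          Complex.exp (-(2 * π * I) * ∑ t, (k t : ℂ) * (x j t : ℂ)) := by
  intro k hk
  have hband' : ∀ n ∉ indexSet d M, fhat (fun t => (n t : ℝ)) = 0 := by
    intro n hn
    refine hband _ fun hmem => hn ?_
    obtain ⟨m, rfl⟩ := hMeven
    rw [indexSet, Finset.mem_Icc, Pi.le_def, Pi.le_def, ← forall_and]
    intro t
    obtain ⟨h1, h2⟩ := hmem t (Set.mem_univ t)
    push_cast at h1 h2
    have h1' : -(m : ℤ) ≤ n t := by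
      have : -(m : ℝ) ≤ n t := by linarith
      exact_mod_cast this
    have h2' : n t < (m : ℤ) := by
      have : (n t : ℝ) < m := by linarith
      exact_mod_cast this
    push_cast
    omega
  have hpoisson : ∀ y, ftilde y = ∑ n ∈ indexSet d M, fhat (fun t => (n t : ℝ)) *
      Complex.exp (2 * π * I * ∑ t, (n t : ℂ) * (y t : ℂ)) := by
    intro y
    rw [hftilde]
    refine tsum_comp_add_intCast_eq_sum (s := d + 1) hfc hfi hC.le (by simp)
      (fun y => ?_) (fun n => ?_) hband' y
    · convert hdecay y using 3
      ring
    · simp [hfhat]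
  have hquad : ∀ n ∈ indexSet d M,
      ∑ j, w j * Complex.exp (2 * π * I * ∑ t, ((n - k) t : ℂ) * (x j t : ℂ)) =
        if n = k then 1 else 0 := by
    intro n hn
    have hmem : n - k ∈ indexSet d (2 * M) := by
      rw [indexSet, Finset.mem_Icc, Pi.le_def, Pi.le_def, ← forall_and] at hn hk ⊢
      intro t
      have := hn t
      have := hk t
      simp only [Pi.sub_apply]
      push_cast
      omega
    simpa [sub_eq_zero] using hw _ hmem
  symm
  calc ∑ j, w j * ftilde (x j) * Complex.exp (-(2 * π * I) * ∑ t, (k t : ℂ) * (x j t : ℂ))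
      = ∑ j, ∑ n ∈ indexSet d M, fhat (fun t => (n t : ℝ)) *
          (w j * Complex.exp (2 * π * I * ∑ t, ((n - k) t : ℂ) * (x j t : ℂ))) := by
        refine Finset.sum_congr rfl fun j _ => ?_
        rw [hpoisson, Finset.mul_sum, Finset.sum_mul]
        refine Finset.sum_congr rfl fun n _ => ?_
        have hexp : 2 * π * I * ∑ t, ((n - k) t : ℂ) * (x j t : ℂ) =
            2 * π * I * ∑ t, (n t : ℂ) * (x j t : ℂ) +
              -(2 * π * I) * ∑ t, (k t : ℂ) * (x j t : ℂ) := by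
          simp only [Pi.sub_apply, Int.cast_sub, sub_mul, Finset.sum_sub_distrib]
          ring
        rw [hexp, Complex.exp_add]
        ring
    _ = ∑ n ∈ indexSet d M, fhat (fun t => (n t : ℝ)) * if n = k then 1 else 0 := by
        rw [Finset.sum_comm]
        refine Finset.sum_congr rfl fun n hn => ?_
        rw [← Finset.mul_sum, hquad n hn]
    _ = fhat (fun t => (k t : ℝ)) := by simp [hk]
end
end

section
/- Let d ≥ 1, M > 0 a real number, and fix t ∈ (−M/2, M/2)^d and x ∈ ℝ^d. Define the equispaced points y_ℓ := (ℓ_1/M, …, ℓ_d/M) for ℓ ∈ ℤ^d. Then the symmetric partial sums of the cardinal series converge to the exponential: lim_{n→∞} ∑_{ℓ∈ℤ^d, |ℓ_t|≤n for all t} e^{2πi t·y_ℓ} sinc(Mπ(x − y_ℓ)) = e^{2πi t·x}, where sinc of a vector is the product of the one-dimensional sinc functions of its components. -/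
noncomputable section
open scoped Real BigOperators
open Complex Filter

/-- The one-dimensional `sinc` function: `sin x / x` for `x ≠ 0` and `1` at `0`. -/
def sinc (x : ℝ) : ℝ := if x = 0 then 1 else Real.sin x / x

/-- The `d`-variate `sinc` function, the product of the componentwise `sinc`s. -/
def dsinc {d : ℕ} (x : Fin d → ℝ) : ℝ := ∏ t, sinc (x t)

lemma sinc_mul_self_abs_le (x : ℝ) : |sinc x| * |x| ≤ 1 := by
  unfold sinc
  split_ifs with h
  · simp [h]
  · rw [← abs_mul, div_mul_cancel₀ _ h]
    exact Real.abs_sin_le_one x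

lemma integral_exp_eq_sinc (v : ℝ) :
    ∫ s in (-1 / 2 : ℝ)..(-1 / 2 + 1), Complex.exp (2 * π * I * s * v) = (sinc (π * v) : ℂ) := by
  have hpi : (π : ℂ) ≠ 0 := by exact_mod_cast Real.pi_ne_zero
  by_cases hv : v = 0
  · simp [hv, sinc]
  have hv' : (v : ℂ) ≠ 0 := by exact_mod_cast hv
  have hc : 2 * π * I * v ≠ 0 := by simp [hpi, hv', I_ne_zero]
  have h := integral_exp_mul_complex (a := -1 / 2) (b := -1 / 2 + 1) hc
  have he : ∀ s : ℝ, 2 * π * I * s * v = 2 * π * I * v * s := fun s => by ring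
  simp_rw [he, h]
  have e1 : 2 * π * I * v * ((-1 / 2 + 1 : ℝ) : ℂ) = (π * v : ℝ) * I := by push_cast; ring
  have e2 : 2 * π * I * v * ((-1 / 2 : ℝ) : ℂ) = -(π * v : ℝ) * I := by push_cast; ring
  rw [e1, e2, sinc, if_neg (mul_ne_zero Real.pi_ne_zero hv), ofReal_div, ofReal_sin, Complex.sin]
  push_cast
  field_simp
  linear_combination (cexp (↑π * ↑v * I) - cexp (-(↑π * ↑v * I))) * I_sq

lemma summable_sinc_add_sinc (u : ℝ) :
    Summable fun l : ℤ => sinc (π * (u - l)) + sinc (π * (u - l + 1)) := by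
  have h2 (a : ℝ) : Summable fun l : ℤ => 1 / |(l : ℝ) + a| ^ (2 : ℝ) :=
    (Real.summable_one_div_int_add_rpow a 2).2 (by norm_num)
  have hfin (a : ℝ) : ∀ᶠ l : ℤ in cofinite, (l : ℝ) ≠ a := by
    refine Set.Subsingleton.finite fun i hi j hj => ?_
    simp only [Set.mem_compl_iff, Set.mem_ofPred_eq, not_not] at hi hj
    exact_mod_cast hi.trans hj.symm
  refine Summable.of_norm_bounded_eventually ((h2 (-u)).add (h2 (-(u + 1)))) ?_
  filter_upwards [hfin u, hfin (u + 1)] with l h0 h1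
  have h0' : u - l ≠ 0 := fun h => h0 (by linarith)
  have h1' : u - l + 1 ≠ 0 := fun h => h1 (by linarith)
  have hpi := Real.pi_pos
  rw [sinc, if_neg (mul_ne_zero hpi.ne' h0'), sinc, if_neg (mul_ne_zero hpi.ne' h1'),
    show π * (u - l + 1) = π * (u - l) + π by ring, Real.sin_add_pi, Real.norm_eq_abs,
    show (l : ℝ) + -u = -(u - l) by ring, show (l : ℝ) + -(u + 1) = -(u - l + 1) by ring,
    abs_neg, abs_neg, Real.rpow_two, Real.rpow_two, sq_abs, sq_abs]
  set w := u - l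
  have h3 : Real.sin (π * w) / (π * w) + -Real.sin (π * w) / (π * w + π)
      = Real.sin (π * w) / π * (w⁻¹ * (w + 1)⁻¹) := by
    rw [show π * w + π = π * (w + 1) by ring]
    field_simp
    ring
  have h4 : |Real.sin (π * w) / π| ≤ 1 := by
    rw [abs_div, abs_of_pos hpi, div_le_one hpi]
    linarith [Real.abs_sin_le_one (π * w), Real.pi_gt_three]
  rw [h3, abs_mul, one_div, one_div, ← inv_pow, ← inv_pow]
  refine (mul_le_of_le_one_left (abs_nonneg _) h4).trans ?_
  rw [abs_le]
  constructor <;> nlinarith [sq_nonneg (w⁻¹ + (w + 1)⁻¹), sq_nonneg (w⁻¹ - (w + 1)⁻¹),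
    sq_nonneg w⁻¹, sq_nonneg (w + 1)⁻¹]

/-- The factor `1 + e^{2πiθ}` makes the Fourier series of the periodized exponential
absolutely convergent. -/
lemma hasSum_sinc_add_sinc (u θ : ℝ) (hθ : θ ∈ Set.Ioo (-1 / 2 : ℝ) (1 / 2)) :
    HasSum (fun l : ℤ => Complex.exp (2 * π * I * θ * l) *
        ((sinc (π * (u - l)) + sinc (π * (u - l + 1)) : ℝ) : ℂ))
      ((1 + Complex.exp (2 * π * I * θ)) * Complex.exp (2 * π * I * θ * u)) := by
  have : Fact ((0 : ℝ) < 1) := ⟨one_pos⟩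
  let g : ℝ → ℂ := fun s => (1 + Complex.exp (2 * π * I * s)) * Complex.exp (2 * π * I * s * u)
  have hg : Continuous g := by fun_prop
  have hper : g (-1 / 2) = g (-1 / 2 + 1) := by
    have e1 : Complex.exp (2 * π * I * ((-1 / 2 : ℝ) : ℂ)) = -1 := by
      rw [show 2 * π * I * ((-1 / 2 : ℝ) : ℂ) = -(π * I) by push_cast; ring, Complex.exp_neg,
        Complex.exp_pi_mul_I]
      norm_num
    have e2 : Complex.exp (2 * π * I * ((-1 / 2 + 1 : ℝ) : ℂ)) = -1 := by
      rw [show 2 * π * I * ((-1 / 2 + 1 : ℝ) : ℂ) = π * I by push_cast; ring,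
        Complex.exp_pi_mul_I]
    simp only [g, e1, e2, add_neg_cancel, zero_mul]
  let f : C(AddCircle (1 : ℝ), ℂ) :=
    ⟨AddCircle.liftIco 1 (-1 / 2) g, AddCircle.liftIco_continuous hper hg.continuousOn⟩
  have hcoeff (l : ℤ) :
      fourierCoeff f l = ((sinc (π * (u - l)) + sinc (π * (u - l + 1)) : ℝ) : ℂ) := by
    change fourierCoeff (AddCircle.liftIco 1 (-1 / 2) g) l = _
    rw [fourierCoeff_liftIco_eq, fourierCoeffOn_eq_integral]
    have hint (s : ℝ) :
        fourier (-l) (s : AddCircle ((-1 / 2 : ℝ) + 1 - -1 / 2)) • g s =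
          Complex.exp (2 * π * I * s * ((u - l : ℝ) : ℂ)) +
          Complex.exp (2 * π * I * s * ((u - l + 1 : ℝ) : ℂ)) := by
      simp only [g]
      rw [fourier_coe_apply, smul_eq_mul, add_mul, one_mul, mul_add, ← Complex.exp_add,
        ← Complex.exp_add, ← Complex.exp_add]
      congr 2 <;> push_cast <;> ring
    simp_rw [hint]
    rw [intervalIntegral.integral_add
      (by apply Continuous.intervalIntegrable; fun_prop)
      (by apply Continuous.intervalIntegrable; fun_prop),
      integral_exp_eq_sinc, integral_exp_eq_sinc]
    norm_num
  have hsum : Summable (fourierCoeff f) := by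
    rw [funext hcoeff]
    exact Complex.ofRealCLM.summable (summable_sinc_add_sinc u)
  have key := has_pointwise_sum_fourier_series_of_summable hsum (θ : AddCircle (1 : ℝ))
  have hfθ : f (θ : AddCircle (1 : ℝ)) = g θ := by
    have hmem : θ ∈ Set.Ico (-1 / 2 : ℝ) (-1 / 2 + 1) := ⟨hθ.1.le, by linarith [hθ.2]⟩
    change AddCircle.liftIco 1 (-1 / 2) g (θ : AddCircle (1 : ℝ)) = g θ
    exact AddCircle.liftIco_coe_apply hmem
  rw [hfθ] at key
  convert key using 2 with l
  rw [hcoeff, fourier_coe_apply, smul_eq_mul, mul_comm]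
  congr 2
  push_cast
  ring

lemma sum_Icc_neg_succ {E : Type*} [AddCommGroup E] (F : ℤ → E) (n : ℕ) :
    ∑ l ∈ Finset.Icc (-((n + 1 : ℕ) : ℤ)) ((n + 1 : ℕ) : ℤ), F l =
      ∑ l ∈ Finset.Icc (-(n : ℤ)) n, F l + F (n + 1) + F (-n - 1) := by
  have h : Finset.Icc (-((n + 1 : ℕ) : ℤ)) ((n + 1 : ℕ) : ℤ) =
      insert (-(n : ℤ) - 1) (insert ((n : ℤ) + 1) (Finset.Icc (-(n : ℤ)) n)) := by
    ext l
    simp only [Finset.mem_Icc, Finset.mem_insert]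
    lia
  rw [h, Finset.sum_insert (by simp only [Finset.mem_Icc, Finset.mem_insert]; lia),
    Finset.sum_insert (by simp)]
  abel

lemma one_add_mul_sum_Icc (z : ℂ) (hz : z ≠ 0) (a : ℤ → ℂ) (n : ℕ) :
    (1 + z) * ∑ l ∈ Finset.Icc (-(n : ℤ)) n, z ^ l * a l =
      ∑ l ∈ Finset.Icc (-(n : ℤ)) n, z ^ l * (a l + a (l - 1)) +
        z ^ ((n : ℤ) + 1) * a n - z ^ (-(n : ℤ)) * a (-n - 1) := by
  induction n with
  | zero => simp; ring
  | succ n ih =>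
    rw [sum_Icc_neg_succ, sum_Icc_neg_succ, mul_add, mul_add, ih]
    have e1 : z ^ (((n + 1 : ℕ) : ℤ) + 1) = z * z ^ ((n : ℤ) + 1) := by
      rw [zpow_add₀ hz, zpow_one, mul_comm]; push_cast; rfl
    have e2 : z ^ (-(n : ℤ)) = z * z ^ (-(n : ℤ) - 1) := by
      rw [← zpow_one_add₀ hz]; congr 1; ring
    have e3 : -(((n + 1 : ℕ) : ℤ)) = -(n : ℤ) - 1 := by push_cast; ring
    rw [e1, e2, e3]
    push_cast
    rw [add_sub_cancel_right]
    ring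

lemma tendsto_sinc_atTop_zero {b : ℕ → ℝ} (hb : Tendsto (fun n => |b n|) atTop atTop) :
    Tendsto (fun n => sinc (b n)) atTop (nhds 0) := by
  refine squeeze_zero_norm' ?_ hb.inv_tendsto_atTop
  filter_upwards [hb.eventually_gt_atTop 0] with n hn
  rw [Real.norm_eq_abs, Pi.inv_apply, ← one_div, le_div_iff₀ hn]
  exact sinc_mul_self_abs_le _

lemma tendsto_cardinal_series_one (u θ : ℝ) (hθ : θ ∈ Set.Ioo (-1 / 2 : ℝ) (1 / 2)) :
    Tendsto (fun n : ℕ => ∑ l ∈ Finset.Icc (-(n : ℤ)) n,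
        Complex.exp (2 * π * I * θ * l) * (sinc (π * (u - l)) : ℂ))
      atTop (nhds (Complex.exp (2 * π * I * θ * u))) := by
  set z := Complex.exp (2 * π * I * θ) with hzdef
  have hz : z ≠ 0 := Complex.exp_ne_zero _
  have hznorm : ‖z‖ = 1 := by
    rw [hzdef, show 2 * π * I * θ = (2 * π * θ : ℝ) * I by push_cast; ring,
      Complex.norm_exp_ofReal_mul_I]
  have hz1 : 1 + z ≠ 0 := by
    have hcos : 0 < Real.cos (π * θ) := Real.cos_pos_of_mem_Ioo
      ⟨by nlinarith [hθ.1, Real.pi_pos], by nlinarith [hθ.2, Real.pi_pos]⟩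
    intro h
    have hre := congrArg Complex.re h
    rw [hzdef, show 2 * π * I * θ = (2 * (π * θ) : ℝ) * I by push_cast; ring, Complex.add_re,
      Complex.exp_ofReal_mul_I_re, Real.cos_two_mul] at hre
    simp only [one_re, zero_re] at hre
    nlinarith
  have hpow (l : ℤ) : Complex.exp (2 * π * I * θ * l) = z ^ l := by
    rw [hzdef, ← Complex.exp_int_mul, mul_comm]
  simp_rw [hpow]
  have hs := hasSum_sinc_add_sinc u θ hθ
  simp_rw [hpow] at hs
  have hIcc : Tendsto (fun n : ℕ => Finset.Icc (-(n : ℤ)) n) atTop atTop :=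
    Finset.tendsto_Icc_neg_atTop_atTop.comp tendsto_natCast_atTop_atTop
  have hbd {c : ℕ → ℤ} {b : ℕ → ℝ} (hb : Tendsto (fun n => |b n|) atTop atTop) :
      Tendsto (fun n => z ^ c n * (sinc (b n) : ℂ)) atTop (nhds 0) := by
    rw [tendsto_zero_iff_norm_tendsto_zero]
    simpa [hznorm] using (tendsto_sinc_atTop_zero hb).norm
  have hn := tendsto_natCast_atTop_atTop (R := ℝ)
  have hb1 : Tendsto (fun n : ℕ => |π * (u - (n : ℤ))|) atTop atTop := by
    refine tendsto_abs_atBot_atTop.comp (Tendsto.const_mul_atBot Real.pi_pos ?_)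
    simpa [sub_eq_add_neg] using
      tendsto_atBot_add_const_left _ u (tendsto_neg_atTop_atBot.comp hn)
  have hb2 : Tendsto (fun n : ℕ => |π * (u - (-(n : ℤ) - 1 : ℤ))|) atTop atTop := by
    refine tendsto_abs_atTop_atTop.comp (Tendsto.const_mul_atTop Real.pi_pos ?_)
    refine (tendsto_atTop_add_const_left _ (u + 1) hn).congr fun n => ?_
    push_cast
    ring
  have hlim := ((hs.comp hIcc).add (hbd (c := fun n => n + 1) hb1)).sub
    (hbd (c := fun n => -n) hb2)
  have hfin := hlim.const_mul (1 + z)⁻¹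
  rw [add_zero, sub_zero, inv_mul_cancel_left₀ hz1] at hfin
  refine hfin.congr fun n => ?_
  rw [inv_mul_eq_iff_eq_mul₀ hz1,
    one_add_mul_sum_Icc z hz (fun l => (sinc (π * (u - l)) : ℂ)) n]
  simp only [Function.comp_apply]
  congr 2
  refine Finset.sum_congr rfl fun l _ => ?_
  push_cast
  rw [show u - ((l : ℝ) - 1) = u - l + 1 by ring]

/-- for `τ ∈ (-M/2, M/2)^d` and `x ∈ ℝ^d`, the symmetric partial
sums of the cardinal (Shannon) series at the equispaced points `y_ℓ = ℓ/M`
converge to `e^{2πi τ·x}`. -/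
theorem cardinal_series_exp
    (d : ℕ) (hd : 1 ≤ d) (M : ℝ) (hM : 0 < M)
    (τ : Fin d → ℝ) (hτ : ∀ t, τ t ∈ Set.Ioo (-M / 2) (M / 2))
    (x : Fin d → ℝ)
    (y : (Fin d → ℤ) → Fin d → ℝ) (hy : ∀ l t, y l t = (l t : ℝ) / M) :
    Tendsto
      (fun n : ℕ =>
        ∑ l ∈ Finset.Icc (fun _ => -(n : ℤ)) (fun _ => (n : ℤ)),
          Complex.exp (2 * π * I * ∑ t, (τ t : ℂ) * (y l t : ℂ)) *
            (dsinc (fun t => M * π * (x t - y l t)) : ℂ))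
      atTop
      (nhds (Complex.exp (2 * π * I * ∑ t, (τ t : ℂ) * (x t : ℂ)))) := by
  have h1 (t : Fin d) : Tendsto (fun n : ℕ => ∑ l ∈ Finset.Icc (-(n : ℤ)) n,
      Complex.exp (2 * π * I * (τ t * (l / M))) * (sinc (M * π * (x t - l / M)) : ℂ))
      atTop (nhds (Complex.exp (2 * π * I * (τ t * x t)))) := by
    have hM' : (M : ℂ) ≠ 0 := by exact_mod_cast hM.ne'
    have hθ : τ t / M ∈ Set.Ioo (-1 / 2 : ℝ) (1 / 2) := by
      obtain ⟨h, h'⟩ := hτ t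
      exact ⟨by rw [lt_div_iff₀ hM]; linarith, by rw [div_lt_iff₀ hM]; linarith⟩
    convert tendsto_cardinal_series_one (M * x t) (τ t / M) hθ using 2 with n
    · refine Finset.sum_congr rfl fun l _ => ?_
      congr 2
      · push_cast; ring
      · congr 1; field_simp
    · congr 1; push_cast; field_simp
  have hprod := tendsto_finsetProd Finset.univ fun t _ => h1 t
  rw [← Complex.exp_sum, ← Finset.mul_sum] at hprod
  refine hprod.congr fun n => ?_
  rw [Finset.prod_univ_sum]
  refine Finset.sum_congr rfl fun l _ => ?_
  simp only [dsinc, hy, Finset.prod_mul_distrib, Finset.mul_sum, Complex.exp_sum, ofReal_prod,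
    ofReal_div, ofReal_intCast]
end
end
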